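/- Let G be a finite group, c0, c1, m positive integers, b_x, M1, M2 ≥ 0, δ ∈ (0,1), and let σ : ℝ → ℝ be 1-Lipschitz and positively homogeneous. Let Y be a measurable space, ℓ : ℝ × Y → ℝ measurable with |ℓ| ≤ 1 everywhere and t ↦ ℓ(t, y) 1-Lipschitz for every y ∈ Y, and let μ be a probability measure on (inputs) × Y supported on pairs (x,y) with ‖x‖ ≤ b_x. Define the average-pooled network h_{u,w}(x) = Σ_{j∈Fin c1} u_j · (1/|G|) Σ_{g∈G} σ( z_j^{w,x}(g) ). Then with probability at least 1−δ over an i.i.d. sample ((x_1,y_1),…,(x_m,y_m)) drawn from μ^m, simultaneously for all u with ‖u‖ ≤ M1 and all w with ‖w‖ ≤ M2: E_{(x,y)∼μ} ℓ(h_{u,w}(x), y) ≤ (1/m) Σ_{i=1}^m ℓ(h_{u,w}(x_i), y_i) + 2·b_x·M1·M2/√m + 4·√(2·log(4/δ)/m). -/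

import Mathlib

open Finset MeasureTheory

/-- Multi-channel group convolution pre-activation channel:
`z j g = ∑ i, ∑ h, w j i (g⁻¹ h) * x i h`. -/
noncomputable def gconvChannel {G : Type*} [Group G] [Fintype G] {c0 : ℕ}
    (w : Fin c0 → G → ℝ) (x : Fin c0 → G → ℝ) (g : G) : ℝ :=
  ∑ i : Fin c0, ∑ h : G, w i (g⁻¹ * h) * x i h

/-- One-hidden-layer group convolutional network with average pooling. -/
noncomputable def avgPoolNet {G : Type*} [Group G] [Fintype G] {c0 c1 : ℕ}
    (σ : ℝ → ℝ) (u : Fin c1 → ℝ) (w : Fin c1 → Fin c0 → G → ℝ)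
    (x : Fin c0 → G → ℝ) : ℝ :=
  ∑ j : Fin c1, u j *
    ((1 / (Fintype.card G : ℝ)) * ∑ g : G, σ (gconvChannel (w j) x g))


/-- The sign attached to a Boolean. -/
def sgnB (b : Bool) : ℝ := if b then 1 else -1

lemma sgnB_true : sgnB true = 1 := rfl
lemma sgnB_false : sgnB false = -1 := by simp [sgnB]
lemma sgnB_sq (b : Bool) : sgnB b * sgnB b = 1 := by cases b <;> simp [sgnB]
lemma sgnB_abs (b : Bool) : |sgnB b| = 1 := by cases b <;> simp [sgnB]

lemma sum_signs_succ (n : ℕ) (F : (Fin (n + 1) → Bool) → ℝ) :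
    ∑ e, F e = ∑ e : Fin n → Bool, (F (Fin.cons true e) + F (Fin.cons false e)) := by
  rw [← (Fin.consEquiv (fun _ : Fin (n + 1) => Bool)).sum_comp, Fintype.sum_prod_type_right]
  apply Finset.sum_congr rfl
  intro e _
  simp [Fin.consEquiv]

lemma le_iSup_fin {T : Type*} [Finite T] (f : T → ℝ) (t : T) : f t ≤ ⨆ t, f t :=
  le_ciSup (Set.finite_range f).bddAbove t

lemma contraction_step {T : Type*} [Finite T] [Nonempty T] (R a : T → ℝ) (φ : ℝ → ℝ)
    (hφ : LipschitzWith 1 φ) :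
    (⨆ t, (R t + φ (a t))) + (⨆ t, (R t - φ (a t))) ≤
      (⨆ t, (R t + a t)) + (⨆ t, (R t - a t)) := by
  have key : ∀ s t, (R s + φ (a s)) + (R t - φ (a t)) ≤
      (⨆ t, (R t + a t)) + (⨆ t, (R t - a t)) := by
    intro s t
    have h1 := le_iSup_fin (fun t => R t + a t)
    have h2 := le_iSup_fin (fun t => R t - a t)
    have h := hφ.dist_le_mul (a s) (a t)
    simp only [Real.dist_eq, NNReal.coe_one, one_mul] at h
    have h' := le_abs_self (φ (a s) - φ (a t))
    rcases le_total (a s) (a t) with hh | hh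
    · rw [abs_of_nonpos (by linarith : a s - a t ≤ 0)] at h
      have := h1 t
      have := h2 s
      linarith
    · rw [abs_of_nonneg (by linarith : 0 ≤ a s - a t)] at h
      have := h1 s
      have := h2 t
      linarith
  have : (⨆ t, (R t + φ (a t))) ≤ (⨆ t, (R t + a t)) + (⨆ t, (R t - a t))
      - (⨆ t, (R t - φ (a t))) := by
    apply ciSup_le
    intro s
    have : (⨆ t, (R t - φ (a t))) ≤ (⨆ t, (R t + a t)) + (⨆ t, (R t - a t))
      - (R s + φ (a s)) := by
      apply ciSup_le
      intro t
      linarith [key s t]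
    linarith
  linarith

/-- Talagrand's contraction lemma, with an offset, over a finite index type. -/
lemma contraction {T : Type*} [Finite T] [Nonempty T] (n : ℕ) :
    ∀ (R : T → ℝ) (a : T → Fin n → ℝ) (φ : Fin n → ℝ → ℝ), (∀ k, LipschitzWith 1 (φ k)) →
    ∑ e : Fin n → Bool, (⨆ t, (R t + ∑ k, sgnB (e k) * φ k (a t k))) ≤
      ∑ e : Fin n → Bool, (⨆ t, (R t + ∑ k, sgnB (e k) * a t k)) := by
  induction n with
  | zero => intro R a φ _; simp
  | succ n ih =>
    intro R a φ hφ
    rw [sum_signs_succ, sum_signs_succ]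
    simp only [Fin.sum_univ_succ, Fin.cons_zero, Fin.cons_succ, sgnB_true, sgnB_false, one_mul,
      neg_one_mul]
    have h1 := ih (fun t => R t + φ 0 (a t 0)) (fun t k => a t k.succ) (fun k => φ k.succ)
      (fun k => hφ _)
    have h2 := ih (fun t => R t - φ 0 (a t 0)) (fun t k => a t k.succ) (fun k => φ k.succ)
      (fun k => hφ _)
    calc _ = ∑ e : Fin n → Bool,
          (⨆ t, (R t + φ 0 (a t 0) + ∑ k, sgnB (e k) * φ k.succ (a t k.succ)))
          + ∑ e : Fin n → Bool,
          (⨆ t, (R t - φ 0 (a t 0) + ∑ k, sgnB (e k) * φ k.succ (a t k.succ))) := by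
            rw [← Finset.sum_add_distrib]
            simp only [add_assoc, sub_eq_add_neg]
      _ ≤ _ := add_le_add h1 h2
      _ = ∑ e : Fin n → Bool,
          ((⨆ t, ((R t + ∑ k, sgnB (e k) * a t k.succ) + φ 0 (a t 0)))
          + (⨆ t, ((R t + ∑ k, sgnB (e k) * a t k.succ) - φ 0 (a t 0)))) := by
            rw [← Finset.sum_add_distrib]
            simp only [add_right_comm, sub_eq_add_neg]
      _ ≤ ∑ e : Fin n → Bool,
          ((⨆ t, ((R t + ∑ k, sgnB (e k) * a t k.succ) + a t 0))
          + (⨆ t, ((R t + ∑ k, sgnB (e k) * a t k.succ) - a t 0))) :=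
            Finset.sum_le_sum fun e _ => contraction_step _ (fun t => a t 0) (φ 0) (hφ 0)
      _ = _ := by
            simp only [add_right_comm, sub_eq_add_neg, ← add_assoc]

lemma sum_signs_sq (n : ℕ) : ∀ (c : ℝ) (y : Fin n → ℝ),
    ∑ e : Fin n → Bool, (c + ∑ k, sgnB (e k) * y k) ^ 2 = 2 ^ n * (c ^ 2 + ∑ k, y k ^ 2) := by
  induction n with
  | zero => intro c y; simp
  | succ n ih =>
    intro c y
    rw [sum_signs_succ]
    simp only [Fin.sum_univ_succ, Fin.cons_zero, Fin.cons_succ, sgnB_true, sgnB_false, one_mul,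
      neg_one_mul, ← add_assoc]
    rw [Finset.sum_add_distrib, ih, ih]
    ring

/-- Selector second moment bound. -/
lemma selector_sq {I : Type*} [Fintype I] (n : ℕ) (σ : ℝ → ℝ) (hσL : LipschitzWith 1 σ)
    (hσh : ∀ a t : ℝ, 0 ≤ a → σ (a * t) = a * σ t) (x : Fin n → I → ℝ)
    (w : (Fin n → Bool) → I → ℝ) (hw : ∀ e, ∑ i, w e i ^ 2 ≤ 1) :
    ∑ e : Fin n → Bool, (max 0 (∑ k, sgnB (e k) * σ (∑ i, w e i * x k i))) ^ 2 ≤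
      2 ^ n * ∑ k, ∑ i, x k i ^ 2 := by
  set A : (Fin n → Bool) → ℝ := fun e => max 0 (∑ k, sgnB (e k) * σ (∑ i, w e i * x k i)) with hA
  have hA0 : ∀ e, 0 ≤ A e := fun e => le_max_left _ _
  have hAA : ∀ e, A e * (∑ k, sgnB (e k) * σ (∑ i, w e i * x k i)) = A e ^ 2 := by
    intro e
    rcases le_total 0 (∑ k, sgnB (e k) * σ (∑ i, w e i * x k i)) with h | h
    · simp only [hA, max_eq_right h, sq]
    · simp [hA, max_eq_left h]
  let v : (Fin n → Bool) → I → ℝ := fun e i => A e * w e i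
  have h1 := contraction (T := Fin n → Bool) n (fun t => - (∑ i, v t i ^ 2) / 2)
    (fun t k => ∑ i, v t i * x k i) (fun _ => σ) (fun _ => hσL)
  have h2 : ∀ e, A e ^ 2 / 2 ≤ ⨆ t, (- (∑ i, v t i ^ 2) / 2
      + ∑ k, sgnB (e k) * σ (∑ i, v t i * x k i)) := by
    intro e
    refine le_trans ?_ (le_iSup_fin (fun t => (- (∑ i, v t i ^ 2) / 2
      + ∑ k, sgnB (e k) * σ (∑ i, v t i * x k i))) e)
    have e1 : ∑ k, sgnB (e k) * σ (∑ i, v e i * x k i) = A e ^ 2 := by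
      rw [← hAA, Finset.mul_sum]
      apply Finset.sum_congr rfl
      intro k _
      simp only [v, mul_assoc]
      rw [← Finset.mul_sum, hσh _ _ (hA0 e)]
      ring
    have e2 : ∑ i, v e i ^ 2 ≤ A e ^ 2 := by
      simp only [v, mul_pow, ← Finset.mul_sum]
      nlinarith [hw e, sq_nonneg (A e)]
    simp only [e1]
    linarith
  have h3 : ∀ e : Fin n → Bool, (⨆ t, (- (∑ i, v t i ^ 2) / 2
      + ∑ k, sgnB (e k) * ∑ i, v t i * x k i)) ≤ (∑ i, (∑ k, sgnB (e k) * x k i) ^ 2) / 2 := by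
    intro e
    apply ciSup_le
    intro t
    have : ∑ k, sgnB (e k) * ∑ i, v t i * x k i = ∑ i, v t i * ∑ k, sgnB (e k) * x k i := by
      simp only [Finset.mul_sum]
      rw [Finset.sum_comm]
      exact Finset.sum_congr rfl fun i _ => Finset.sum_congr rfl fun k _ => by ring
    rw [this, neg_div, neg_add_le_iff_le_add, ← add_div, ← Finset.sum_add_distrib,
      Finset.sum_div]
    apply Finset.sum_le_sum
    intro i _
    nlinarith [sq_nonneg (v t i - ∑ k, sgnB (e k) * x k i)]
  have h4 : ∑ e : Fin n → Bool, (∑ i, (∑ k, sgnB (e k) * x k i) ^ 2) / 2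
      = (2 ^ n * ∑ k, ∑ i, x k i ^ 2) / 2 := by
    rw [← Finset.sum_div, Finset.sum_comm]
    congr 1
    rw [Finset.sum_comm (s := (Finset.univ : Finset (Fin n))), Finset.mul_sum]
    apply Finset.sum_congr rfl
    intro i _
    have := sum_signs_sq n 0 (fun k => x k i)
    simpa using this
  have h5 : ∑ e, A e ^ 2 / 2 ≤ (2 ^ n * ∑ k, ∑ i, x k i ^ 2) / 2 := by
    rw [← h4]
    exact (Finset.sum_le_sum fun e _ => h2 e).trans (h1.trans (Finset.sum_le_sum fun e _ => h3 e))
  rw [← Finset.sum_div] at h5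
  linarith

/-- Second moment bound for the two-sided supremum. -/
lemma abs_sup_bound {I W : Type*} [Fintype I] [Finite W] [Nonempty W] (n : ℕ)
    (σ : ℝ → ℝ) (hσL : LipschitzWith 1 σ)
    (hσh : ∀ a t : ℝ, 0 ≤ a → σ (a * t) = a * σ t) (x : Fin n → I → ℝ) (r : ℝ)
    (hx : ∑ k, ∑ i, x k i ^ 2 ≤ r)
    (w : W → I → ℝ) (hw : ∀ e, ∑ i, w e i ^ 2 ≤ 1) :
    ∑ e : Fin n → Bool, (⨆ t, |∑ k, sgnB (e k) * σ (∑ i, w t i * x k i)|) ≤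
      2 ^ n * Real.sqrt (2 * r) := by
  choose s hs using fun e : Fin n → Bool =>
    exists_eq_ciSup_of_finite (f := fun t => |∑ k, sgnB (e k) * σ (∑ i, w t i * x k i)|)
  simp only [← hs]
  have h1 := selector_sq n σ hσL hσh x (fun e => w (s e)) (fun e => hw _)
  have h2 := selector_sq n (fun t => - σ t) hσL.neg (fun a t ha => by rw [hσh a t ha]; ring) x
    (fun e => w (s e)) (fun e => hw _)
  have h3 : ∑ e : Fin n → Bool, |∑ k, sgnB (e k) * σ (∑ i, w (s e) i * x k i)| ^ 2
      ≤ 2 ^ n * (2 * r) := by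
    calc _ ≤ _ := ?_
      _ ≤ _ := add_le_add h1 h2
      _ ≤ _ := by
        have : (0:ℝ) < 2 ^ n := by positivity
        nlinarith
    rw [← Finset.sum_add_distrib]
    apply Finset.sum_le_sum
    intro e _
    simp only [mul_neg, Finset.sum_neg_distrib]
    rcases le_total 0 (∑ k, sgnB (e k) * σ (∑ i, w (s e) i * x k i)) with h | h
    · rw [max_eq_right h, max_eq_left (by linarith), sq_abs]; simp
    · rw [max_eq_left h, max_eq_right (by linarith), sq_abs]; simp
  have h4 := sq_sum_le_card_mul_sum_sq (s := (Finset.univ : Finset (Fin n → Bool)))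
    (f := fun e => |∑ k, sgnB (e k) * σ (∑ i, w (s e) i * x k i)|)
  have hc : ((Finset.univ : Finset (Fin n → Bool)).card : ℝ) = 2 ^ n := by simp
  rw [hc] at h4
  have hr : 0 ≤ r := le_trans (Finset.sum_nonneg fun _ _ => Finset.sum_nonneg fun _ _ =>
    sq_nonneg _) hx
  apply abs_le_of_sq_le_sq' _ (by positivity) |>.2
  rw [mul_pow, Real.sq_sqrt (by positivity)]
  calc _ ≤ _ := h4
    _ ≤ (2:ℝ) ^ n * (2 ^ n * (2 * r)) := by gcongr
    _ = _ := by ring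

lemma sum_abs_signs (n : ℕ) :
    ∑ e : Fin n → Bool, |∑ k, sgnB (e k)| ≤ 2 ^ n * Real.sqrt n := by
  have h := sum_signs_sq n 0 (fun _ => 1)
  simp only [zero_add, mul_one] at h
  have h4 := sq_sum_le_card_mul_sum_sq (s := (Finset.univ : Finset (Fin n → Bool)))
    (f := fun e => |∑ k, sgnB (e k)|)
  have hc : ((Finset.univ : Finset (Fin n → Bool)).card : ℝ) = 2 ^ n := by simp
  rw [hc] at h4
  simp only [sq_abs] at h4
  rw [h] at h4
  apply abs_le_of_sq_le_sq' _ (by positivity) |>.2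
  rw [mul_pow, Real.sq_sqrt (by positivity)]
  calc _ ≤ _ := h4
    _ = _ := by simp; ring

lemma integrable_of_bdd {Ω : Type*} [MeasurableSpace Ω] {μ : Measure Ω} [IsFiniteMeasure μ]
    {f : Ω → ℝ} (hf : Measurable f) (C : ℝ) (hC : ∀ x, |f x| ≤ C) : Integrable f μ :=
  Integrable.of_bound hf.aestronglyMeasurable C (Filter.Eventually.of_forall hC)

lemma hoeffding_step {Ω : Type*} [MeasurableSpace Ω] {μ : Measure Ω} [IsProbabilityMeasure μ]
    (X : Ω → ℝ) (hX : Measurable X) (c : ℝ) (hc : ∀ x y, |X x - X y| ≤ c) (t : ℝ) :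
    ∫ z, Real.exp (t * (X z - ∫ y, X y ∂μ)) ∂μ ≤ Real.exp (c ^ 2 * t ^ 2 / 2) := by
  have : Nonempty Ω := nonempty_of_isProbabilityMeasure μ
  obtain ⟨z0⟩ := this
  have hc0 : 0 ≤ c := (abs_nonneg _).trans (hc z0 z0)
  have h := (ProbabilityTheory.hasSubgaussianMGF_of_mem_Icc (μ := μ) (X := X) (a := X z0 - c)
    (b := X z0 + c) hX.aemeasurable (Filter.Eventually.of_forall fun z => by
      have := abs_le.1 (hc z z0)
      constructor <;> linarith)).mgf_le t
  have e : (((‖X z0 + c - (X z0 - c)‖₊ / 2) ^ 2 : NNReal) : ℝ) = c ^ 2 := by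
    push_cast
    rw [show X z0 + c - (X z0 - c) = 2 * c by ring, Real.norm_eq_abs, abs_of_nonneg (by linarith)]
    ring
  rw [e] at h
  exact h

lemma integral_pi_succ {Z : Type*} [MeasurableSpace Z] (μ : Measure Z) [IsProbabilityMeasure μ]
    (n : ℕ) (F : (Fin (n + 1) → Z) → ℝ) (hF : Measurable F) (C : ℝ) (hC : ∀ S, |F S| ≤ C) :
    ∫ S, F S ∂(Measure.pi fun _ : Fin (n + 1) => μ) =
      ∫ z, ∫ S, F (Fin.cons z S) ∂(Measure.pi fun _ : Fin n => μ) ∂μ := by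
  have h := (measurePreserving_piFinSuccAbove (fun _ : Fin (n + 1) => μ) 0).symm
  rw [← h.integral_comp (MeasurableEquiv.measurableEmbedding _)]
  rw [integral_prod]
  · simp [MeasurableEquiv.piFinSuccAbove, Fin.insertNthEquiv]
  · exact integrable_of_bdd (hF.comp h.measurable) C fun _ => hC _

lemma measurable_cons {Z : Type*} [MeasurableSpace Z] (n : ℕ) :
    Measurable (fun p : Z × (Fin n → Z) => (Fin.cons p.1 p.2 : Fin (n + 1) → Z)) := by
  rw [measurable_pi_iff]
  intro i
  refine Fin.cases ?_ (fun j => ?_) i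
  · simpa using measurable_fst
  · simp only [Fin.cons_succ]
    exact (measurable_pi_apply j).comp measurable_snd

/-- Exponential moment form of McDiarmid's inequality (with a non-sharp constant). -/
lemma mcdiarmid {Z : Type*} [MeasurableSpace Z] (μ : Measure Z) [IsProbabilityMeasure μ]
    (c t : ℝ) (n : ℕ) : ∀ (F : (Fin n → Z) → ℝ) (_ : Measurable F) (C : ℝ)
    (_ : ∀ S, |F S| ≤ C) (_ : ∀ S i z, |F (Function.update S i z) - F S| ≤ c),
    ∫ S, Real.exp (t * (F S - ∫ S', F S' ∂(Measure.pi fun _ : Fin n => μ)))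
      ∂(Measure.pi fun _ : Fin n => μ) ≤ Real.exp (n * (c ^ 2 * t ^ 2 / 2)) := by
  induction n with
  | zero =>
    intro F hF C hC hd
    rw [Measure.pi_of_empty]
    simp
  | succ n ih =>
    intro F hF C hC hd
    set ν := Measure.pi fun _ : Fin n => μ with hν
    set E := ∫ S', F S' ∂(Measure.pi fun _ : Fin (n + 1) => μ) with hE
    let Gf : Z → ℝ := fun z => ∫ S, F (Fin.cons z S) ∂ν
    have hmz : ∀ z : Z, Measurable fun S : Fin n → Z => F (Fin.cons z S) := fun z =>
      hF.comp ((measurable_cons n).comp measurable_prodMk_left)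
    have hE' : E = ∫ z, Gf z ∂μ := integral_pi_succ μ n F hF C hC
    have hGm : Measurable Gf :=
      ((hF.comp (measurable_cons n)).stronglyMeasurable.integral_prod_right').measurable
    have hGC : ∀ z, |Gf z| ≤ C := fun z => by
      have := norm_integral_le_of_norm_le_const (μ := ν) (f := fun S => F (Fin.cons z S))
        (Filter.Eventually.of_forall fun S => hC _)
      simpa using this
    have hEC : |E| ≤ C := by
      have := norm_integral_le_of_norm_le_const (μ := Measure.pi fun _ : Fin (n + 1) => μ)
        (f := F) (Filter.Eventually.of_forall fun S => hC _)
      simpa using this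
    have hGd : ∀ z z', |Gf z - Gf z'| ≤ c := by
      intro z z'
      simp only [Gf]
      rw [← integral_sub (integrable_of_bdd (hmz _) C fun _ => hC _)
        (integrable_of_bdd (hmz _) C fun _ => hC _)]
      have := norm_integral_le_of_norm_le_const (μ := ν)
        (f := fun S => F (Fin.cons z S) - F (Fin.cons z' S)) (C := c)
        (Filter.Eventually.of_forall fun S => by
          have := hd (Fin.cons z' S) 0 z
          rwa [Fin.update_cons_zero] at this)
      simpa using this
    have hexpb : ∀ (a : ℝ), |a| ≤ C → ∀ b, |b| ≤ C →
        |Real.exp (t * (a - b))| ≤ Real.exp (|t| * (2 * C)) := by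
      intro a ha b hb
      rw [abs_of_pos (Real.exp_pos _)]
      apply Real.exp_le_exp.2
      refine (le_abs_self _).trans ?_
      rw [abs_mul]
      gcongr
      have := abs_sub a b
      linarith
    rw [integral_pi_succ μ n _ (by fun_prop) (Real.exp (|t| * (2 * C)))
      (fun S => hexpb _ (hC _) _ hEC)]
    have hin : ∀ z, ∫ S, Real.exp (t * (F (Fin.cons z S) - E)) ∂ν
        ≤ Real.exp (n * (c ^ 2 * t ^ 2 / 2)) * Real.exp (t * (Gf z - E)) := by
      intro z
      have h := ih (fun S => F (Fin.cons z S)) (hmz z) C (fun _ => hC _) (by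
        intro S i y
        have := hd (Fin.cons z S) i.succ y
        rwa [← Fin.cons_update] at this)
      calc _ = ∫ S, Real.exp (t * (F (Fin.cons z S) - Gf z)) * Real.exp (t * (Gf z - E)) ∂ν := by
            congr 1; ext S; rw [← Real.exp_add]; congr 1; ring
        _ = (∫ S, Real.exp (t * (F (Fin.cons z S) - Gf z)) ∂ν) * Real.exp (t * (Gf z - E)) :=
            integral_mul_const _ _
        _ ≤ _ := mul_le_mul_of_nonneg_right h (Real.exp_pos _).le
    have hmm : Measurable fun z => ∫ S, Real.exp (t * (F (Fin.cons z S) - E)) ∂ν := by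
      have : Measurable (fun p : Z × (Fin n → Z) =>
          Real.exp (t * (F (Fin.cons p.1 p.2) - E))) := by
        have := hF.comp (measurable_cons (Z := Z) n)
        exact ((this.sub_const E).const_mul t).exp
      exact (this.stronglyMeasurable.integral_prod_right').measurable
    calc _ ≤ ∫ z, Real.exp (n * (c ^ 2 * t ^ 2 / 2)) * Real.exp (t * (Gf z - E)) ∂μ := by
          apply integral_mono _ _ hin
          · apply integrable_of_bdd hmm (Real.exp (|t| * (2 * C)))
            intro z
            have := norm_integral_le_of_norm_le_const (μ := ν)
              (f := fun S => Real.exp (t * (F (Fin.cons z S) - E)))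
              (Filter.Eventually.of_forall fun S => hexpb _ (hC _) _ hEC)
            simpa using this
          · apply Integrable.const_mul
            exact integrable_of_bdd (by fun_prop) (Real.exp (|t| * (2 * C)))
              fun z => hexpb _ (hGC z) _ hEC
      _ = Real.exp (n * (c ^ 2 * t ^ 2 / 2)) * ∫ z, Real.exp (t * (Gf z - E)) ∂μ :=
          integral_const_mul _ _
      _ ≤ Real.exp (n * (c ^ 2 * t ^ 2 / 2)) * Real.exp (c ^ 2 * t ^ 2 / 2) := by
          gcongr
          rw [hE']
          exact hoeffding_step Gf hGm c hGd t
      _ = _ := by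
          rw [← Real.exp_add]; congr 1; push_cast; ring

lemma mcdiarmid_tail {Z : Type*} [MeasurableSpace Z] (μ : Measure Z) [IsProbabilityMeasure μ]
    (m : ℕ) (hm : 0 < m) (F : (Fin m → Z) → ℝ) (hF : Measurable F) (C : ℝ)
    (hC : ∀ S, |F S| ≤ C) (hd : ∀ S i z, |F (Function.update S i z) - F S| ≤ 2 / m)
    (r : ℝ) (hr : 0 ≤ r) :
    (Measure.pi fun _ : Fin m => μ).real
      {S | r ≤ F S - ∫ S', F S' ∂(Measure.pi fun _ : Fin m => μ)}
      ≤ Real.exp (- (r ^ 2 * m / 8)) := by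
  have hm' : (0:ℝ) < m := by exact_mod_cast hm
  set E := ∫ S', F S' ∂(Measure.pi fun _ : Fin m => μ) with hE
  have hEC : |E| ≤ C := by
    have := norm_integral_le_of_norm_le_const (μ := Measure.pi fun _ : Fin m => μ)
      (f := F) (Filter.Eventually.of_forall fun S => hC _)
    simpa using this
  have h := mcdiarmid μ (2 / m) (r * m / 4) m F hF C hC hd
  have h2 := ProbabilityTheory.measure_ge_le_exp_mul_mgf (μ := Measure.pi fun _ : Fin m => μ)
    (X := fun S => F S - E) (t := r * m / 4) r (by positivity)
    (integrable_of_bdd (by fun_prop) (Real.exp (|r * m / 4| * (2 * C))) (by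
      intro S
      rw [abs_of_pos (Real.exp_pos _)]
      apply Real.exp_le_exp.2
      refine (le_abs_self _).trans ?_
      rw [abs_mul]
      gcongr
      have := abs_sub (F S) E
      have := hC S
      linarith))
  refine h2.trans ?_
  refine (mul_le_mul_of_nonneg_left h (Real.exp_pos _).le).trans ?_
  rw [← Real.exp_add]
  apply Real.exp_le_exp.2
  apply le_of_eq
  field_simp
  ring

lemma exists_balanced (m : ℕ) (e : Fin (2 * m) → Bool) :
    ∃ P : Finset (Fin (2 * m)), P.card = m ∧
      ∑ k, |sgnB (e k) - (if k ∈ P then 1 else -1)| ≤ |∑ k, sgnB (e k)| := by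
  classical
  set T0 : Finset (Fin (2 * m)) := Finset.univ.filter (fun k => e k = true) with hT0
  have hbal : ∀ P : Finset (Fin (2 * m)), P.card = m →
      ∑ k : Fin (2 * m), (if k ∈ P then (1:ℝ) else -1) = 0 := by
    intro P hP
    have h1 : ∀ k : Fin (2 * m), (if k ∈ P then (1:ℝ) else -1) = 2 * (if k ∈ P then 1 else 0) - 1 := by
      intro k; split_ifs <;> norm_num
    simp only [h1, Finset.sum_sub_distrib, ← Finset.mul_sum]
    simp [hP]
  rcases le_total m T0.card with h | h
  · obtain ⟨P, hPT, hP⟩ := Finset.exists_subset_card_eq h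
    refine ⟨P, hP, ?_⟩
    refine le_trans (le_of_eq ?_) (le_abs_self _)
    rw [← sub_zero (∑ k, sgnB (e k)), ← hbal P hP, ← Finset.sum_sub_distrib]
    apply Finset.sum_congr rfl
    intro k _
    apply abs_of_nonneg
    by_cases hk : k ∈ P
    · have : e k = true := by simpa [hT0] using hPT hk
      simp [hk, this, sgnB]
    · cases hek : e k <;> simp [hk, sgnB]
  · obtain ⟨P, hPT, -, hP⟩ := Finset.exists_subsuperset_card_eq (Finset.subset_univ T0) h
      (by simp; omega)
    refine ⟨P, hP, ?_⟩
    refine le_trans (le_of_eq ?_) (neg_le_abs _)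
    rw [← zero_sub (∑ k, sgnB (e k)), ← hbal P hP, ← Finset.sum_sub_distrib]
    apply Finset.sum_congr rfl
    intro k _
    rw [abs_sub_comm]
    apply abs_of_nonneg
    by_cases hk : k ∈ P
    · cases hek : e k <;> norm_num [hk, sgnB]
    · have : e k = false := by
        by_contra hne
        exact hk (hPT (by simpa [hT0] using hne))
      simp [hk, this, sgnB]

lemma abs_iSup_le {T : Type*} [Finite T] [Nonempty T] (f : T → ℝ) (C : ℝ)
    (h : ∀ t, |f t| ≤ C) : |⨆ t, f t| ≤ C := by
  obtain ⟨t0⟩ := ‹Nonempty T›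
  rw [abs_le]
  constructor
  · exact (abs_le.1 (h t0)).1.trans (le_iSup_fin f t0)
  · have : Nonempty T := ⟨t0⟩
    exact ciSup_le fun t => (abs_le.1 (h t)).2

lemma abs_sum_le_card {n : ℕ} (f : Fin n → ℝ) (h : ∀ k, |f k| ≤ 1) : |∑ k, f k| ≤ n := by
  refine (Finset.abs_sum_le_sum_abs _ _).trans ?_
  refine (Finset.sum_le_sum fun k _ => h k).trans ?_
  simp

lemma balanced_symm {Z T : Type*} [MeasurableSpace Z] (μ : Measure Z) [IsProbabilityMeasure μ]
    [Finite T] [Nonempty T] (f : T → Z → ℝ) (hf : ∀ t, Measurable (f t))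
    (hb : ∀ t z, |f t z| ≤ 1) (m : ℕ) (P : Finset (Fin (2 * m))) (hP : P.card = m) :
    ∫ S, (⨆ t, (m * (∫ z, f t z ∂μ) - ∑ i, f t (S i))) ∂(Measure.pi fun _ : Fin m => μ) ≤
      ∫ z, (⨆ t, ∑ k, (if k ∈ P then 1 else -1) * f t (z k))
        ∂(Measure.pi fun _ : Fin (2 * m) => μ) := by
  classical
  let a : Fin m ≃ {k // k ∈ P} := (Fintype.equivFinOfCardEq (by simp [hP])).symm
  let b : Fin m ≃ {k // ¬ k ∈ P} := (Fintype.equivFinOfCardEq (by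
    rw [Fintype.card_subtype_compl]; simp [hP]; omega)).symm
  let E : Fin m ⊕ Fin m ≃ Fin (2 * m) := (Equiv.sumCongr a b).trans (Equiv.sumCompl (· ∈ P))
  set ν := Measure.pi fun _ : Fin m => μ with hν
  have mp1 := measurePreserving_piCongrLeft (α := fun _ : Fin (2 * m) => Z) (fun _ => μ) E
  have mp2 := measurePreserving_sumPiEquivProdPi_symm (fun _ : Fin m ⊕ Fin m => μ)
  have hm1 : Measurable fun z : Fin (2 * m) → Z =>
      (⨆ t, ∑ k, (if k ∈ P then (1:ℝ) else -1) * f t (z k)) :=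
    Measurable.iSup fun t => by fun_prop
  rw [← mp1.integral_comp (MeasurableEquiv.measurableEmbedding _),
    ← mp2.integral_comp (MeasurableEquiv.measurableEmbedding _)]
  have key : ∀ p : (Fin m → Z) × (Fin m → Z), (⨆ t, ∑ k, (if k ∈ P then (1:ℝ) else -1) *
      f t ((MeasurableEquiv.piCongrLeft (fun _ : Fin (2 * m) => Z) E)
        ((MeasurableEquiv.sumPiEquivProdPi (fun _ : Fin m ⊕ Fin m => Z)).symm p) k))
      = ⨆ t, (∑ i, f t (p.1 i) - ∑ i, f t (p.2 i)) := by
    intro p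
    congr 1
    ext t
    rw [← E.sum_comp, Fintype.sum_sum_type]
    simp only [MeasurableEquiv.coe_piCongrLeft, Equiv.piCongrLeft_apply_apply]
    have e1 : ∀ i, E (Sum.inl i) ∈ P := fun i => by simp [E]
    have e2 : ∀ i, E (Sum.inr i) ∉ P := fun i => by simpa [E] using (b i).2
    simp only [e1, e2, if_true, if_false, one_mul, neg_one_mul, Finset.sum_neg_distrib]
    rfl
  simp only [key]
  have hm2 : Measurable fun p : (Fin m → Z) × (Fin m → Z) =>
      ⨆ t, (∑ i, f t (p.1 i) - ∑ i, f t (p.2 i)) :=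
    Measurable.iSup fun t => by fun_prop
  have hb2 : ∀ (p : (Fin m → Z) × (Fin m → Z)) t,
      |∑ i, f t (p.1 i) - ∑ i, f t (p.2 i)| ≤ 2 * m := by
    intro p t
    have h1 := abs_sum_le_card (fun i => f t (p.1 i)) fun i => hb _ _
    have h2 := abs_sum_le_card (fun i => f t (p.2 i)) fun i => hb _ _
    have := abs_sub (∑ i, f t (p.1 i)) (∑ i, f t (p.2 i))
    linarith
  have hInt : Integrable (fun p : (Fin m → Z) × (Fin m → Z) =>
      ⨆ t, (∑ i, f t (p.1 i) - ∑ i, f t (p.2 i))) (ν.prod ν) :=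
    integrable_of_bdd hm2 (2 * m) fun p => abs_iSup_le _ _ (hb2 p)
  have hfi : ∀ t, Integrable (f t) μ := fun t => integrable_of_bdd (hf t) 1 (hb t)
  rw [integral_prod_symm _ hInt]
  apply integral_mono
  · apply integrable_of_bdd (Measurable.iSup fun t => by fun_prop) (2 * m)
    intro S
    apply abs_iSup_le
    intro t
    have h2 := abs_sum_le_card (fun i => f t (S i)) fun i => hb _ _
    have h1 : |(m:ℝ) * ∫ z, f t z ∂μ| ≤ m := by
      rw [abs_mul, Nat.abs_cast]
      have := norm_integral_le_of_norm_le_const (μ := μ) (f := f t) (C := 1)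
        (Filter.Eventually.of_forall fun z => hb t z)
      simp at this
      exact mul_le_of_le_one_right (by positivity) this
    have := abs_sub (m * ∫ z, f t z ∂μ) (∑ i, f t (S i))
    linarith
  · exact hInt.integral_prod_right
  · intro S
    apply ciSup_le
    intro t
    have h1 : m * (∫ z, f t z ∂μ) - ∑ i, f t (S i)
        = ∫ S', (∑ i, f t (S' i) - ∑ i, f t (S i)) ∂ν := by
      have hi : ∀ i, Integrable (fun S' : Fin m → Z => f t (S' i)) ν := fun i =>
        integrable_of_bdd (by fun_prop) 1 fun _ => hb _ _
      rw [integral_sub (integrable_finsetSum _ fun i _ => hi i) (integrable_const _),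
        integral_finsetSum _ fun i _ => hi i]
      have : ∀ i, ∫ S' : Fin m → Z, f t (S' i) ∂ν = ∫ z, f t z ∂μ := by
        intro i
        have hmp := measurePreserving_eval (fun _ : Fin m => μ) i
        rw [← hmp.map_eq, integral_map hmp.measurable.aemeasurable
          (hf t).aestronglyMeasurable]
      simp [this]
    rw [h1]
    apply integral_mono
    · exact integrable_of_bdd (by fun_prop) (2 * m) fun S' => hb2 (S', S) t
    · exact integrable_of_bdd (hm2.comp measurable_prodMk_right) (2 * m)
        fun S' => abs_iSup_le _ _ (hb2 (S', S))
    · intro S'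
      exact le_iSup_fin (fun t => (∑ i, f t (S' i) - ∑ i, f t (S i))) t

lemma symm_step {Z T : Type*} [MeasurableSpace Z] (μ : Measure Z) [IsProbabilityMeasure μ]
    [Finite T] [Nonempty T] (f : T → Z → ℝ) (hf : ∀ t, Measurable (f t))
    (hb : ∀ t z, |f t z| ≤ 1) (m : ℕ) (e : Fin (2 * m) → Bool) :
    ∫ S, (⨆ t, (m * (∫ z, f t z ∂μ) - ∑ i, f t (S i))) ∂(Measure.pi fun _ : Fin m => μ) ≤
      ∫ z, (⨆ t, ∑ k, sgnB (e k) * f t (z k))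
        ∂(Measure.pi fun _ : Fin (2 * m) => μ) + |∑ k, sgnB (e k)| := by
  classical
  obtain ⟨P, hP, hd⟩ := exists_balanced m e
  refine (balanced_symm μ f hf hb m P hP).trans ?_
  have hi : ∀ s : Fin (2 * m) → ℝ, (∀ k, |s k| = 1) →
      Integrable (fun z : Fin (2 * m) → Z => ⨆ t, ∑ k, s k * f t (z k))
        (Measure.pi fun _ : Fin (2 * m) => μ) := by
    intro s hs
    apply integrable_of_bdd (Measurable.iSup fun t => by fun_prop) ((2 * m : ℕ) : ℝ)
    intro z
    apply abs_iSup_le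
    intro t
    apply abs_sum_le_card
    intro k
    rw [abs_mul, hs, one_mul]
    exact hb _ _
  have h1 := hi (fun k => sgnB (e k)) fun k => sgnB_abs _
  have h2 := hi (fun k => if k ∈ P then 1 else -1) fun k => by split_ifs <;> simp
  have : ∫ z, ((⨆ t, ∑ k, sgnB (e k) * f t (z k)) + |∑ k, sgnB (e k)|)
        ∂(Measure.pi fun _ : Fin (2 * m) => μ) = _ := integral_add h1 (integrable_const _)
  simp only [integral_const, probReal_univ, one_smul] at this
  rw [← this]
  apply integral_mono h2 (h1.add (integrable_const _))
  intro z
  apply ciSup_le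
  intro t
  have h3 := le_iSup_fin (fun t => ∑ k, sgnB (e k) * f t (z k)) t
  have h4 : ∑ k, (if k ∈ P then 1 else -1) * f t (z k) - ∑ k, sgnB (e k) * f t (z k)
      ≤ ∑ k, |sgnB (e k) - (if k ∈ P then 1 else -1)| := by
    rw [← Finset.sum_sub_distrib]
    apply Finset.sum_le_sum
    intro k _
    rw [← sub_mul, abs_sub_comm]
    refine (le_abs_self _).trans ?_
    rw [abs_mul]
    exact mul_le_of_le_one_right (abs_nonneg _) (hb _ _)
  simp only [Pi.add_apply] at h3 ⊢
  linarith

lemma symm_all {Z T : Type*} [MeasurableSpace Z] (μ : Measure Z) [IsProbabilityMeasure μ]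
    [Finite T] [Nonempty T] (f : T → Z → ℝ) (hf : ∀ t, Measurable (f t))
    (hb : ∀ t z, |f t z| ≤ 1) (m : ℕ) (K : ℝ)
    (hK : ∀ᵐ z ∂(Measure.pi fun _ : Fin (2 * m) => μ),
      ∑ e : Fin (2 * m) → Bool, (⨆ t, ∑ k, sgnB (e k) * f t (z k)) ≤ 2 ^ (2 * m) * K) :
    ∫ S, (⨆ t, (m * (∫ z, f t z ∂μ) - ∑ i, f t (S i))) ∂(Measure.pi fun _ : Fin m => μ) ≤
      K + Real.sqrt ((2 * m : ℕ) : ℝ) := by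
  set D := ∫ S, (⨆ t, (m * (∫ z, f t z ∂μ) - ∑ i, f t (S i))) ∂(Measure.pi fun _ : Fin m => μ)
  have h1 : ∑ e : Fin (2 * m) → Bool, D ≤ _ :=
    Finset.sum_le_sum fun e _ => symm_step μ f hf hb m e
  have hi : ∀ e : Fin (2 * m) → Bool,
      Integrable (fun z : Fin (2 * m) → Z => ⨆ t, ∑ k, sgnB (e k) * f t (z k))
        (Measure.pi fun _ : Fin (2 * m) => μ) := by
    intro e
    apply integrable_of_bdd (Measurable.iSup fun t => by fun_prop) ((2 * m : ℕ) : ℝ)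
    intro z
    apply abs_iSup_le
    intro t
    apply abs_sum_le_card
    intro k
    rw [abs_mul, sgnB_abs, one_mul]
    exact hb _ _
  rw [Finset.sum_add_distrib, ← integral_finsetSum _ fun e _ => hi e] at h1
  have h2 := integral_mono_ae (integrable_finsetSum _ fun e _ => hi e)
    (integrable_const (2 ^ (2 * m) * K)) hK
  simp only [integral_const, probReal_univ, one_smul] at h2
  have h3 := sum_abs_signs (2 * m)
  have h4 : ∑ e : Fin (2 * m) → Bool, D = 2 ^ (2 * m) * D := by simp
  rw [h4] at h1
  have h5 : (0:ℝ) < 2 ^ (2 * m) := by positivity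
  refine le_of_mul_le_mul_left ?_ h5
  rw [mul_add]
  linarith

lemma gconv_eq {G : Type*} [Group G] [Fintype G] {c0 : ℕ}
    (w : Fin c0 → G → ℝ) (x : Fin c0 → G → ℝ) (g : G) :
    gconvChannel w x g = ∑ i : Fin c0 × G, w i.1 i.2 * x i.1 (g * i.2) := by
  rw [gconvChannel, Fintype.sum_prod_type]
  apply Finset.sum_congr rfl
  intro i _
  rw [← Equiv.sum_comp (Equiv.mulLeft g)]
  simp

/-- Rademacher complexity bound for (a finite family of) average-pooled networks. -/
lemma net_bound {G T : Type*} [Group G] [Fintype G] [Finite T] [Nonempty T] {c0 c1 n : ℕ}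
    (hc1 : 0 < c1) (bx M1 M2 : ℝ) (hbx : 0 ≤ bx) (hM1 : 0 ≤ M1) (hM2 : 0 ≤ M2)
    (σ : ℝ → ℝ) (hσL : LipschitzWith 1 σ)
    (hσh : ∀ a t : ℝ, 0 ≤ a → σ (a * t) = a * σ t)
    (u : T → Fin c1 → ℝ) (w : T → Fin c1 → Fin c0 → G → ℝ)
    (hu : ∀ t, Real.sqrt (∑ j : Fin c1, (u t j) ^ 2) ≤ M1)
    (hw : ∀ t, Real.sqrt (∑ j : Fin c1, ∑ k : Fin c0, ∑ g : G, (w t j k g) ^ 2) ≤ M2)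
    (x : Fin n → Fin c0 → G → ℝ)
    (hx : ∀ k, Real.sqrt (∑ i : Fin c0, ∑ g : G, (x k i g) ^ 2) ≤ bx) :
    ∑ e : Fin n → Bool, (⨆ t, ∑ k, sgnB (e k) * avgPoolNet σ (u t) (w t) (x k)) ≤
      2 ^ n * (M1 * M2 * Real.sqrt (2 * (n * bx ^ 2))) := by
  have : Nonempty (Fin c1) := ⟨⟨0, hc1⟩⟩
  let N : T → Fin c1 → ℝ := fun t j => Real.sqrt (∑ i : Fin c0 × G, (w t j i.1 i.2) ^ 2)
  have hN0 : ∀ t j, 0 ≤ N t j := fun t j => Real.sqrt_nonneg _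
  have hNsq : ∀ t j, N t j ^ 2 = ∑ i : Fin c0 × G, (w t j i.1 i.2) ^ 2 := fun t j =>
    Real.sq_sqrt (Finset.sum_nonneg fun _ _ => sq_nonneg _)
  let v : T × Fin c1 → Fin c0 × G → ℝ := fun p i => (N p.1 p.2)⁻¹ * w p.1 p.2 i.1 i.2
  have hv : ∀ p, ∑ i, v p i ^ 2 ≤ 1 := by
    intro p
    simp only [v, mul_pow, ← Finset.mul_sum]
    rw [← hNsq, ← mul_pow]
    by_cases h : N p.1 p.2 = 0
    · simp [h]
    · rw [inv_mul_cancel₀ h]; simp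
  have hwv : ∀ t j i, w t j i.1 i.2 = N t j * v (t, j) i := by
    intro t j i
    by_cases h : N t j = 0
    · have h2 := hNsq t j
      rw [h, zero_pow two_ne_zero, eq_comm, Finset.sum_eq_zero_iff_of_nonneg
        (fun _ _ => sq_nonneg _)] at h2
      rw [h, zero_mul]
      exact pow_eq_zero_iff two_ne_zero |>.1 (h2 i (Finset.mem_univ _))
    · simp only [v]
      rw [mul_inv_cancel_left₀ h]
  let y : G → Fin n → Fin c0 × G → ℝ := fun g k i => x k i.1 (g * i.2)
  let Mg : G → (Fin n → Bool) → ℝ := fun g e =>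
    ⨆ p : T × Fin c1, |∑ k, sgnB (e k) * σ (∑ i, v p i * y g k i)|
  have hy : ∀ g, ∑ k, ∑ i, y g k i ^ 2 ≤ n * bx ^ 2 := by
    intro g
    have : ∀ k, ∑ i, y g k i ^ 2 ≤ bx ^ 2 := by
      intro k
      have h1 := (Real.sqrt_le_left hbx).1 (hx k)
      refine le_trans (le_of_eq ?_) h1
      rw [Fintype.sum_prod_type]
      apply Finset.sum_congr rfl
      intro i _
      exact Equiv.sum_comp (Equiv.mulLeft g) (fun h => x k i h ^ 2)
    refine (Finset.sum_le_sum fun k _ => this k).trans ?_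
    simp
  have hMg : ∀ g, ∑ e, Mg g e ≤ 2 ^ n * Real.sqrt (2 * (n * bx ^ 2)) := fun g =>
    abs_sup_bound n σ hσL hσh (y g) _ (hy g) v hv
  have hMg0 : ∀ g e, 0 ≤ Mg g e := fun g e => Real.iSup_nonneg fun _ => abs_nonneg _
  have hcG : (0:ℝ) < Fintype.card G := by
    exact_mod_cast Fintype.card_pos
  have huN : ∀ t, ∑ j, |u t j| * N t j ≤ M1 * M2 := by
    intro t
    have h1 := Real.sum_mul_le_sqrt_mul_sqrt Finset.univ (fun j => |u t j|) (fun j => N t j)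
    refine h1.trans ?_
    simp only [sq_abs, hNsq, Fintype.sum_prod_type]
    exact mul_le_mul (hu t) (hw t) (Real.sqrt_nonneg _) hM1
  have hpt : ∀ e : Fin n → Bool, (⨆ t, ∑ k, sgnB (e k) * avgPoolNet σ (u t) (w t) (x k)) ≤
      M1 * M2 * ((1 / (Fintype.card G : ℝ)) * ∑ g, Mg g e) := by
    intro e
    apply ciSup_le
    intro t
    have e1 : ∑ k, sgnB (e k) * avgPoolNet σ (u t) (w t) (x k)
        = ∑ j, u t j * ((1 / (Fintype.card G : ℝ)) * ∑ g, (N t j *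
          ∑ k, sgnB (e k) * σ (∑ i, v (t, j) i * y g k i))) := by
      have : ∀ j g k, σ (gconvChannel (w t j) (x k) g)
          = N t j * σ (∑ i, v (t, j) i * y g k i) := by
        intro j g k
        rw [gconv_eq, ← hσh _ _ (hN0 t j), Finset.mul_sum]
        congr 1
        apply Finset.sum_congr rfl
        intro i _
        rw [hwv, mul_assoc]
      simp only [avgPoolNet, this, Finset.mul_sum]
      rw [Finset.sum_comm]
      apply Finset.sum_congr rfl
      intro j _
      rw [Finset.sum_comm]
      apply Finset.sum_congr rfl
      intro g _
      apply Finset.sum_congr rfl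
      intro k _
      ring
    rw [e1]
    calc _ ≤ ∑ j, (|u t j| * N t j) * ((1 / (Fintype.card G : ℝ)) * ∑ g, Mg g e) := by
          apply Finset.sum_le_sum
          intro j _
          refine (le_abs_self _).trans ?_
          rw [abs_mul, mul_assoc, abs_mul, abs_of_pos (by positivity : 0 < 1 / (Fintype.card G : ℝ)),
            mul_left_comm (N t j)]
          gcongr
          refine (Finset.abs_sum_le_sum_abs _ _).trans ?_
          rw [Finset.mul_sum]
          apply Finset.sum_le_sum
          intro g _
          rw [abs_mul, abs_of_nonneg (hN0 t j)]
          gcongr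
          exact le_iSup_fin (fun p : T × Fin c1 =>
              |∑ k, sgnB (e k) * σ (∑ i, v p i * y g k i)|) (t, j)
      _ = (∑ j, |u t j| * N t j) * ((1 / (Fintype.card G : ℝ)) * ∑ g, Mg g e) := by
          rw [Finset.sum_mul]
      _ ≤ _ := by
          apply mul_le_mul_of_nonneg_right (huN t)
          have := Finset.sum_nonneg fun g (_ : g ∈ Finset.univ) => hMg0 g e
          positivity
  refine (Finset.sum_le_sum fun e _ => hpt e).trans ?_
  rw [← Finset.mul_sum, ← Finset.mul_sum, Finset.sum_comm]
  have h1 : ∑ g, ∑ e, Mg g e ≤ Fintype.card G * (2 ^ n * Real.sqrt (2 * (n * bx ^ 2))) := by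
    refine (Finset.sum_le_sum fun g _ => hMg g).trans ?_
    simp
  calc _ ≤ M1 * M2 * ((1 / (Fintype.card G : ℝ)) *
        (Fintype.card G * (2 ^ n * Real.sqrt (2 * (n * bx ^ 2))))) := by gcongr
    _ = _ := by field_simp

lemma measurable_net {G : Type*} [Group G] [Fintype G] {c0 c1 : ℕ} (σ : ℝ → ℝ)
    (hσ : Continuous σ) (u : Fin c1 → ℝ) (w : Fin c1 → Fin c0 → G → ℝ) :
    Measurable (avgPoolNet σ u w) := by
  have : Continuous (avgPoolNet σ u w) := by
    unfold avgPoolNet gconvChannel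
    fun_prop
  exact this.measurable

lemma continuous_net {G : Type*} [Group G] [Fintype G] {c0 c1 : ℕ} (σ : ℝ → ℝ)
    (hσ : Continuous σ) (x : Fin c0 → G → ℝ) :
    Continuous (fun p : (Fin c1 → ℝ) × (Fin c1 → Fin c0 → G → ℝ) =>
      avgPoolNet σ p.1 p.2 x) := by
  unfold avgPoolNet gconvChannel
  fun_prop

/-- Generalization bound for a finite family. -/
lemma finite_family {G T : Type*} [Group G] [Fintype G] [Finite T] [Nonempty T]
    (c0 c1 m : ℕ) (hc1 : 0 < c1) (hm : 0 < m)
    (bx M1 M2 : ℝ) (hbx : 0 ≤ bx) (hM1 : 0 ≤ M1) (hM2 : 0 ≤ M2)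
    (δ : ℝ) (hδ0 : 0 < δ) (hδ1 : δ < 1)
    (σ : ℝ → ℝ) (hσL : LipschitzWith 1 σ)
    (hσh : ∀ a t : ℝ, 0 ≤ a → σ (a * t) = a * σ t)
    {Y : Type*} [MeasurableSpace Y]
    (ℓ : ℝ → Y → ℝ)
    (hℓmeas : Measurable (Function.uncurry ℓ))
    (hℓbdd : ∀ t y, |ℓ t y| ≤ 1)
    (hℓlip : ∀ y, LipschitzWith 1 fun t => ℓ t y)
    (μ : Measure ((Fin c0 → G → ℝ) × Y)) [IsProbabilityMeasure μ]
    (hsupp : μ {p | Real.sqrt (∑ k : Fin c0, ∑ g : G, (p.1 k g) ^ 2) ≤ bx} = 1)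
    (u : T → Fin c1 → ℝ) (w : T → Fin c1 → Fin c0 → G → ℝ)
    (hu : ∀ t, Real.sqrt (∑ j : Fin c1, (u t j) ^ 2) ≤ M1)
    (hw : ∀ t, Real.sqrt (∑ j : Fin c1, ∑ k : Fin c0, ∑ g : G, (w t j k g) ^ 2) ≤ M2) :
    ENNReal.ofReal (1 - δ) ≤ (Measure.pi fun _ : Fin m => μ)
      {S : Fin m → (Fin c0 → G → ℝ) × Y | ∀ t,
          (∫ p, ℓ (avgPoolNet σ (u t) (w t) p.1) p.2 ∂μ) ≤
            (1 / (m : ℝ)) * ∑ i : Fin m, ℓ (avgPoolNet σ (u t) (w t) (S i).1) (S i).2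
              + 2 * (bx * M1 * M2 / Real.sqrt m)
              + 4 * Real.sqrt (2 * Real.log (4 / δ) / m)} := by
  have hm' : (0:ℝ) < m := by exact_mod_cast hm
  let f : T → (Fin c0 → G → ℝ) × Y → ℝ := fun t p => ℓ (avgPoolNet σ (u t) (w t) p.1) p.2
  have hf : ∀ t, Measurable (f t) := fun t =>
    hℓmeas.comp (((measurable_net σ hσL.continuous (u t) (w t)).comp measurable_fst).prodMk
      measurable_snd)
  have hb : ∀ t z, |f t z| ≤ 1 := fun t z => hℓbdd _ _
  have hIb : ∀ t, |∫ z, f t z ∂μ| ≤ 1 := by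
    intro t
    have := norm_integral_le_of_norm_le_const (μ := μ) (f := f t) (C := 1)
        (Filter.Eventually.of_forall fun z => hb t z)
    simpa using this
  let F : (Fin m → (Fin c0 → G → ℝ) × Y) → ℝ := fun S =>
    ⨆ t, ((∫ z, f t z ∂μ) - (1 / (m:ℝ)) * ∑ i, f t (S i))
  have hF : Measurable F := Measurable.iSup fun t => by fun_prop
  have hFC : ∀ S, |F S| ≤ 2 := by
    intro S
    apply abs_iSup_le
    intro t
    have h2 := abs_sum_le_card (fun i => f t (S i)) fun i => hb _ _
    have h3 : |(1 / (m:ℝ)) * ∑ i, f t (S i)| ≤ 1 := by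
      rw [abs_mul, abs_of_pos (by positivity : 0 < 1 / (m:ℝ)), one_div, inv_mul_le_iff₀ hm']
      linarith
    have := abs_sub (∫ z, f t z ∂μ) ((1 / (m:ℝ)) * ∑ i, f t (S i))
    have := hIb t
    linarith
  have hFd1 : ∀ S S' : Fin m → (Fin c0 → G → ℝ) × Y,
      (∀ t, |∑ i, f t (S i) - ∑ i, f t (S' i)| ≤ 2) → F S - F S' ≤ 2 / m := by
    intro S S' h
    rw [sub_le_iff_le_add]
    apply ciSup_le
    intro t
    have h1 := le_iSup_fin (fun t => ((∫ z, f t z ∂μ) - (1 / (m:ℝ)) * ∑ i, f t (S' i))) t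
    have h2 := (abs_le.1 (h t)).1
    have h3 : (1 / (m:ℝ)) * ∑ i, f t (S' i) - (1 / (m:ℝ)) * ∑ i, f t (S i) ≤ 2 / m := by
      rw [← mul_sub, one_div_mul_eq_div]
      gcongr
      linarith
    simp only [F] at h1 ⊢
    linarith
  have hFd : ∀ S i z, |F (Function.update S i z) - F S| ≤ 2 / m := by
    intro S i z
    have h : ∀ t, |∑ k, f t (Function.update S i z k) - ∑ k, f t (S k)| ≤ 2 := by
      intro t
      rw [← Finset.sum_sub_distrib, Finset.sum_eq_single i]
      · rw [Function.update_self]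
        have := abs_sub (f t z) (f t (S i))
        have := hb t z
        have := hb t (S i)
        linarith
      · intro k _ hk
        rw [Function.update_of_ne hk, sub_self]
      · simp
    rw [abs_le]
    constructor
    · have := hFd1 S (Function.update S i z) fun t => by rw [abs_sub_comm]; exact h t
      linarith
    · exact hFd1 _ _ h
  set ν := Measure.pi fun _ : Fin m => μ with hν
  set D := ∫ S, F S ∂ν with hD
  set r : ℝ := 2 * Real.sqrt (2 * Real.log (1 / δ) / m) with hr
  have hr0 : 0 ≤ r := by positivity
  have hlog : 0 ≤ Real.log (1 / δ) := Real.log_nonneg (by rw [le_div_iff₀ hδ0]; linarith)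
  have htail := mcdiarmid_tail μ m hm F hF 2 hFC hFd r hr0
  have hexp : Real.exp (- (r ^ 2 * m / 8)) = δ := by
    have : r ^ 2 * m / 8 = Real.log (1 / δ) := by
      rw [hr, mul_pow, Real.sq_sqrt (by positivity)]
      field_simp
      norm_num
      ring
    rw [this, one_div, Real.log_inv, neg_neg, Real.exp_log hδ0]
  rw [hexp] at htail
  have hae : ∀ᵐ p ∂μ, Real.sqrt (∑ k : Fin c0, ∑ g : G, (p.1 k g) ^ 2) ≤ bx := by
    have hms : MeasurableSet {p : (Fin c0 → G → ℝ) × Y |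
        Real.sqrt (∑ k : Fin c0, ∑ g : G, (p.1 k g) ^ 2) ≤ bx} := by
      apply measurableSet_le _ measurable_const
      have : Continuous fun x : Fin c0 → G → ℝ =>
        Real.sqrt (∑ k : Fin c0, ∑ g : G, (x k g) ^ 2) := by fun_prop
      exact this.measurable.comp measurable_fst
    exact (mem_ae_iff_prob_eq_one hms).2 hsupp
  have hae2 : ∀ᵐ z ∂(Measure.pi fun _ : Fin (2 * m) => μ), ∀ i,
      Real.sqrt (∑ k : Fin c0, ∑ g : G, ((z i).1 k g) ^ 2) ≤ bx := by
    rw [ae_all_iff]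
    intro i
    exact (measurePreserving_eval (fun _ : Fin (2 * m) => μ) i).quasiMeasurePreserving.ae hae
  have hsym := symm_all μ f hf hb m (M1 * M2 * Real.sqrt (2 * (((2 * m : ℕ) : ℝ) * bx ^ 2))) (by
    filter_upwards [hae2] with z hz
    have h1 := contraction (T := T) (2 * m) (fun _ => 0)
      (fun t k => avgPoolNet σ (u t) (w t) (z k).1) (fun k a => ℓ a (z k).2) (fun k => hℓlip _)
    simp only [zero_add] at h1
    exact h1.trans (net_bound hc1 bx M1 M2 hbx hM1 hM2 σ hσL hσh u w hu hw (fun k => (z k).1) hz))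
  have hDeq : D = (1 / (m:ℝ)) * ∫ S, (⨆ t, (m * (∫ z, f t z ∂μ) - ∑ i, f t (S i))) ∂ν := by
    rw [← integral_const_mul]
    refine integral_congr_ae (Filter.Eventually.of_forall fun S => ?_)
    beta_reduce
    simp only [F]
    rw [Real.mul_iSup_of_nonneg (by positivity)]
    congr 1
    ext t
    rw [mul_sub, ← mul_assoc, one_div_mul_cancel hm'.ne', one_mul]
  have hs : Real.sqrt m * Real.sqrt m = m := Real.mul_self_sqrt hm'.le
  have hs0 : 0 < Real.sqrt m := Real.sqrt_pos.2 hm'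
  have hDle : D ≤ 2 * (bx * M1 * M2 / Real.sqrt m) + Real.sqrt (2 / m) := by
    rw [hDeq]
    refine (mul_le_mul_of_nonneg_left hsym (by positivity)).trans (le_of_eq ?_)
    have e1 : Real.sqrt (2 * (((2 * m : ℕ) : ℝ) * bx ^ 2)) = 2 * bx * Real.sqrt m := by
      rw [show 2 * (((2 * m : ℕ) : ℝ) * bx ^ 2) = (2 * bx) ^ 2 * m by push_cast; ring,
        Real.sqrt_mul (by positivity), Real.sqrt_sq (by positivity)]
    have e2 : Real.sqrt ((2 * m : ℕ) : ℝ) = Real.sqrt 2 * Real.sqrt m := by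
      push_cast
      rw [Real.sqrt_mul (by positivity)]
    rw [e1, e2, Real.sqrt_div (by positivity)]
    rw [← hs]
    rw [Real.sqrt_mul_self hs0.le]
    field_simp
  have hfin : D + r ≤ 2 * (bx * M1 * M2 / Real.sqrt m)
      + 4 * Real.sqrt (2 * Real.log (4 / δ) / m) := by
    have hl4 : Real.log (4 / δ) = Real.log 4 + Real.log (1 / δ) := by
      rw [← Real.log_mul (by norm_num) (by positivity)]
      congr 1
      ring
    have h4 : 1 ≤ Real.log 4 := by
      rw [show (4:ℝ) = 2 ^ 2 by norm_num, Real.log_pow]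
      have := Real.log_two_gt_d9
      push_cast
      linarith
    have g1 : Real.sqrt (2 / m) ≤ Real.sqrt (2 * Real.log (4 / δ) / m) := by
      apply Real.sqrt_le_sqrt
      gcongr
      linarith
    have g2 : Real.sqrt (2 * Real.log (1 / δ) / m) ≤ Real.sqrt (2 * Real.log (4 / δ) / m) := by
      apply Real.sqrt_le_sqrt
      gcongr
      norm_num
    have g3 : 0 ≤ Real.sqrt (2 * Real.log (4 / δ) / m) := Real.sqrt_nonneg _
    linarith
  have hmB : MeasurableSet {S | r ≤ F S - D} := measurableSet_le measurable_const (by fun_prop)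
  calc ENNReal.ofReal (1 - δ) ≤ ENNReal.ofReal (ν.real {S | r ≤ F S - D}ᶜ) := by
        apply ENNReal.ofReal_le_ofReal
        rw [probReal_compl_eq_one_sub hmB]
        linarith
    _ = ν {S | r ≤ F S - D}ᶜ := ofReal_measureReal
    _ ≤ _ := by
        apply measure_mono
        intro S hS t
        simp only [Set.mem_compl_iff, Set.mem_setOf_eq, not_le] at hS
        have h1 := le_iSup_fin (fun t => ((∫ z, f t z ∂μ) - (1 / (m:ℝ)) * ∑ i, f t (S i))) t
        simp only [F, f] at h1 hS
        linarith
theorem generalization_bound_average_pooling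
    {G : Type*} [Group G] [Fintype G]
    (c0 c1 m : ℕ) (hc0 : 0 < c0) (hc1 : 0 < c1) (hm : 0 < m)
    (bx M1 M2 : ℝ) (hbx : 0 ≤ bx) (hM1 : 0 ≤ M1) (hM2 : 0 ≤ M2)
    (δ : ℝ) (hδ0 : 0 < δ) (hδ1 : δ < 1)
    (σ : ℝ → ℝ) (hσL : LipschitzWith 1 σ)
    (hσh : ∀ a t : ℝ, 0 ≤ a → σ (a * t) = a * σ t)
    {Y : Type*} [MeasurableSpace Y]
    (ℓ : ℝ → Y → ℝ)
    (hℓmeas : Measurable (Function.uncurry ℓ))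
    (hℓbdd : ∀ t y, |ℓ t y| ≤ 1)
    (hℓlip : ∀ y, LipschitzWith 1 fun t => ℓ t y)
    (μ : Measure ((Fin c0 → G → ℝ) × Y)) [IsProbabilityMeasure μ]
    (hsupp : μ {p | Real.sqrt (∑ k : Fin c0, ∑ g : G, (p.1 k g) ^ 2) ≤ bx} = 1) :
    (Measure.pi fun _ : Fin m => μ)
      {S : Fin m → (Fin c0 → G → ℝ) × Y |
        ∀ (u : Fin c1 → ℝ) (w : Fin c1 → Fin c0 → G → ℝ),
          Real.sqrt (∑ j : Fin c1, (u j) ^ 2) ≤ M1 →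
          Real.sqrt (∑ j : Fin c1, ∑ k : Fin c0, ∑ g : G, (w j k g) ^ 2) ≤ M2 →
          (∫ p, ℓ (avgPoolNet σ u w p.1) p.2 ∂μ) ≤
            (1 / (m : ℝ)) * ∑ i : Fin m, ℓ (avgPoolNet σ u w (S i).1) (S i).2
              + 2 * (bx * M1 * M2 / Real.sqrt m)
              + 4 * Real.sqrt (2 * Real.log (4 / δ) / m)}
      ≥ ENNReal.ofReal (1 - δ) := by
  classical
  let C : Set ((Fin c1 → ℝ) × (Fin c1 → Fin c0 → G → ℝ)) :=
    {p | Real.sqrt (∑ j : Fin c1, (p.1 j) ^ 2) ≤ M1 ∧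
      Real.sqrt (∑ j : Fin c1, ∑ k : Fin c0, ∑ g : G, (p.2 j k g) ^ 2) ≤ M2}
  have hne : Nonempty C := ⟨⟨0, by simp [C, hM1, hM2]⟩⟩
  let d : ℕ → C := TopologicalSpace.denseSeq C
  have hd : DenseRange d := TopologicalSpace.denseRange_denseSeq C
  let L : C → (Fin c0 → G → ℝ) × Y → ℝ := fun θ p => ℓ (avgPoolNet σ θ.1.1 θ.1.2 p.1) p.2
  have hLm : ∀ θ, Measurable (L θ) := fun θ =>
    hℓmeas.comp (((measurable_net σ hσL.continuous θ.1.1 θ.1.2).comp measurable_fst).prodMk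
      measurable_snd)
  have hLc : ∀ p, Continuous fun θ => L θ p := fun p =>
    (hℓlip p.2).continuous.comp ((continuous_net σ hσL.continuous p.1).comp continuous_subtype_val)
  have hIc : Continuous fun θ => ∫ p, L θ p ∂μ := by
    apply continuous_of_dominated (bound := fun _ => 1)
    · exact fun θ => (hLm θ).aestronglyMeasurable
    · exact fun θ => Filter.Eventually.of_forall fun p => hℓbdd _ _
    · exact integrable_const _
    · exact Filter.Eventually.of_forall fun p => hLc p
  let K : ℝ := 2 * (bx * M1 * M2 / Real.sqrt m) + 4 * Real.sqrt (2 * Real.log (4 / δ) / m)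
  let A : ℕ → Set (Fin m → (Fin c0 → G → ℝ) × Y) := fun N =>
    {S | ∀ t : Fin (N + 1), (∫ p, L (d t) p ∂μ) ≤ (1 / (m : ℝ)) * ∑ i : Fin m, L (d t) (S i)
      + 2 * (bx * M1 * M2 / Real.sqrt m) + 4 * Real.sqrt (2 * Real.log (4 / δ) / m)}
  have hA : ∀ N, ENNReal.ofReal (1 - δ) ≤ (Measure.pi fun _ : Fin m => μ) (A N) := fun N =>
    finite_family (T := Fin (N + 1)) c0 c1 m hc1 hm bx M1 M2 hbx hM1 hM2 δ hδ0 hδ1 σ hσL hσh ℓ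
      hℓmeas hℓbdd hℓlip μ hsupp (fun t => (d t).1.1) (fun t => (d t).1.2)
      (fun t => (d t).2.1) (fun t => (d t).2.2)
  have hAm : ∀ N, MeasurableSet (A N) := by
    intro N
    simp only [A, Set.setOf_forall]
    refine MeasurableSet.iInter fun t => measurableSet_le measurable_const ?_
    have := hLm (d t)
    fun_prop
  have hAanti : Antitone A := by
    intro N N' h S hS t
    exact hS ⟨t.1, by omega⟩
  have hI : ENNReal.ofReal (1 - δ) ≤ (Measure.pi fun _ : Fin m => μ) (⋂ N, A N) := by
    rw [hAanti.measure_iInter (fun N => (hAm N).nullMeasurableSet) ⟨0, measure_ne_top _ _⟩]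
    exact le_iInf hA
  refine hI.trans (measure_mono ?_)
  intro S hS u w hu hw
  have hcl : IsClosed {θ : C | (∫ p, L θ p ∂μ) ≤ (1 / (m : ℝ)) * ∑ i : Fin m, L θ (S i)
      + 2 * (bx * M1 * M2 / Real.sqrt m) + 4 * Real.sqrt (2 * Real.log (4 / δ) / m)} := by
    apply isClosed_le hIc
    have : Continuous fun θ => ∑ i : Fin m, L θ (S i) :=
      continuous_finsetSum _ fun i _ => hLc (S i)
    fun_prop
  have hall := hd.induction_on (p := fun θ : C =>
    (∫ p, L θ p ∂μ) ≤ (1 / (m : ℝ)) * ∑ i : Fin m, L θ (S i)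
      + 2 * (bx * M1 * M2 / Real.sqrt m) + 4 * Real.sqrt (2 * Real.log (4 / δ) / m))
    ⟨(u, w), hu, hw⟩ hcl (fun n => by
      have := Set.mem_iInter.1 hS n
      exact this ⟨n, by omega⟩)
  exact hall
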